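/- Let p_1,…,p_N be constants with 2N/(N+2) < p_i for all i, p_h < N and p^∨ < p_h*, and let s be a constant with 2 < s < p_h*. Set θ = (1/2 − 1/s)/((N+2)/(2N) − 1/p_h). Then θ ∈ (0,1) and there exists a constant C, depending only on N and a (and on p_1,…,p_N, s), such that for every continuously differentiable function u on the closure of K_a: ‖u‖_{s,K_a} ≤ C Σ_{i=1}^N ( ‖D_i u‖_{p_i,K_a} + ‖u‖_{2,K_a} )^θ · ‖u‖_{2,K_a}^{1−θ}. -/

import Mathlib

noncomputable section
open MeasureTheory Real Filter

/-- The open parallelepiped `K_a = {x : |x_i| < a_i}`. -/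
def Ka {N : ℕ} (a : Fin N → ℝ) : Set (Fin N → ℝ) := {x | ∀ i, |x i| < a i}

/-- The `i`-th partial derivative `D_i`. -/
def Dop {N : ℕ} (i : Fin N) (f : (Fin N → ℝ) → ℝ) : (Fin N → ℝ) → ℝ :=
  fun x => fderiv ℝ f x (Pi.single i 1)

/-- The `L^q(Ω)` norm. -/
def Lnorm {N : ℕ} (q : ℝ) (Ω : Set (Fin N → ℝ)) (v : (Fin N → ℝ) → ℝ) : ℝ :=
  (∫ x in Ω, |v x| ^ q) ^ (1 / q)

open Set in
lemma oneD (b : ℝ) (hb : 0 < b) (g : ℝ → ℝ) (hg : ContDiffOn ℝ 1 g (Ioo (-b) b)) (t : ℝ) (ht : 1 < t)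
    (x : ℝ) (hx : x ∈ Ioo (-b) b) :
    ENNReal.ofReal (|g x| ^ t) ≤ ∫⁻ y in Ioo (-b) b,
      ENNReal.ofReal ((2 * b)⁻¹ * |g y| ^ t + t * |g y| ^ (t - 1) * |deriv g y|) := by
  set G : ℝ → ℝ := fun y => |g y| ^ t with hG
  have hGc : ContDiffOn ℝ 1 G (Ioo (-b) b) := by
    have := (contDiff_norm_rpow (E := ℝ) ht).comp_contDiffOn hg
    exact this
  have hd : ∀ y ∈ Ioo (-b) b, ‖deriv G y‖ₑ = ENNReal.ofReal (t * |g y| ^ (t - 1) * |deriv g y|) := by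
    intro y hy
    have h1 : HasDerivAt g (deriv g y) y :=
      ((hg.differentiableOn (by norm_num)).differentiableAt (isOpen_Ioo.mem_nhds hy)).hasDerivAt
    have h2 : HasDerivAt G (t * |g y| ^ (t - 2) * g y * deriv g y) y :=
      HasDerivAt.comp y (hasDerivAt_abs_rpow (g y) ht) h1
    rw [h2.deriv, Real.enorm_eq_ofReal_abs, abs_mul, abs_mul, abs_mul, abs_of_pos (by linarith : 0 < t),
      abs_of_nonneg (by positivity : 0 ≤ |g y| ^ (t - 2))]
    congr 2
    rw [mul_assoc]
    congr 1
    rcases eq_or_ne (g y) 0 with h0 | h0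
    · rw [h0, abs_zero, mul_zero, Real.zero_rpow (by linarith)]
    · rw [show t - 1 = (t - 2) + 1 by ring, Real.rpow_add_one (abs_ne_zero.mpr h0)]
  set J : ENNReal := ∫⁻ y in Ioo (-b) b, ENNReal.ofReal (t * |g y| ^ (t - 1) * |deriv g y|) with hJ
  have key : ∀ y z : ℝ, y ∈ Ioo (-b) b → z ∈ Ioo (-b) b → y ≤ z → ‖G z - G y‖ₑ ≤ J := by
    intro y z hy hz hyz
    have hsub : Icc y z ⊆ Ioo (-b) b := fun w hw => ⟨hy.1.trans_le hw.1, hw.2.trans_lt hz.2⟩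
    refine (enorm_sub_le_lintegral_deriv_of_contDiffOn_Icc (hGc.mono hsub) hyz).trans ?_
    rw [setLIntegral_congr_fun measurableSet_Icc (fun w hw => hd w (hsub hw))]
    exact lintegral_mono_set hsub
  have key2 : ∀ y ∈ Ioo (-b) b, ENNReal.ofReal (G x) ≤ ENNReal.ofReal (G y) + J := by
    intro y hy
    have h1 : ‖G x - G y‖ₑ ≤ J := by
      rcases le_total y x with h | h
      · exact key y x hy hx h
      · have := key x y hx hy h
        rwa [← enorm_neg, neg_sub] at this
    calc ENNReal.ofReal (G x) ≤ ENNReal.ofReal (G y + |G x - G y|) := by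
          apply ENNReal.ofReal_le_ofReal
          linarith [le_abs_self (G x - G y)]
      _ ≤ ENNReal.ofReal (G y) + ENNReal.ofReal |G x - G y| := ENNReal.ofReal_add_le
      _ ≤ _ := by
          rw [← Real.enorm_eq_ofReal_abs]
          gcongr
  have hcm : ENNReal.ofReal (2 * b)⁻¹ * volume (Ioo (-b) b) = 1 := by
    rw [Real.volume_Ioo, ← ENNReal.ofReal_mul (by positivity)]
    rw [show (2 * b)⁻¹ * (b - -b) = 1 by field_simp; ring]
    simp
  have hGm : AEMeasurable (fun y => ENNReal.ofReal ((2 * b)⁻¹ * G y)) (volume.restrict (Ioo (-b) b)) := by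
    apply AEMeasurable.ennreal_ofReal
    exact ((hGc.continuousOn.aemeasurable measurableSet_Ioo).const_mul _)
  calc ENNReal.ofReal (G x) = ∫⁻ y in Ioo (-b) b, ENNReal.ofReal (2 * b)⁻¹ * ENNReal.ofReal (G x) := by
        rw [lintegral_const, Measure.restrict_apply_univ, mul_right_comm, hcm, one_mul]
    _ ≤ ∫⁻ y in Ioo (-b) b, (ENNReal.ofReal ((2 * b)⁻¹ * G y) + ENNReal.ofReal (2 * b)⁻¹ * J) := by
        refine setLIntegral_mono' measurableSet_Ioo fun y hy => ?_
        rw [ENNReal.ofReal_mul (by positivity), ← mul_add]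
        gcongr
        exact key2 y hy
    _ = (∫⁻ y in Ioo (-b) b, ENNReal.ofReal ((2 * b)⁻¹ * G y)) + J := by
        rw [lintegral_add_left' hGm, lintegral_const, Measure.restrict_apply_univ, mul_right_comm, hcm, one_mul]
    _ = _ := by
        rw [hJ, ← lintegral_add_left' hGm]
        refine lintegral_congr fun y => ?_
        rw [ENNReal.ofReal_add] <;> positivity

section abstractLp
variable {α : Type*} [MeasurableSpace α] {μ : Measure α}

lemma memLp_abs_rpow [IsFiniteMeasure μ] {f : α → ℝ} (hf : AEStronglyMeasurable f μ) {M : ℝ}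
    (hM : ∀ᵐ x ∂μ, |f x| ≤ M) {e : ℝ} (he : 0 ≤ e) (q : ENNReal) :
    MemLp (fun x => |f x| ^ e) q μ := by
  refine MemLp.of_bound ?_ (M ^ e) ?_
  · exact ((hf.aemeasurable.norm).pow_const e).aestronglyMeasurable
  · filter_upwards [hM] with x hx
    rw [Real.norm_eq_abs, abs_of_nonneg (by positivity)]
    exact Real.rpow_le_rpow (abs_nonneg _) hx he

lemma holder_bdd [IsFiniteMeasure μ] {f g : α → ℝ} (hf : AEStronglyMeasurable f μ) {M : ℝ}
    (hM : ∀ᵐ x ∂μ, |f x| ≤ M) (hg : AEStronglyMeasurable g μ) (hM' : ∀ᵐ x ∂μ, |g x| ≤ M)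
    {c d P Q : ℝ} (hPQ : P.HolderConjugate Q) (hc : 0 ≤ c) (hd : 0 ≤ d) :
    ∫ x, |f x| ^ c * |g x| ^ d ∂μ ≤
      (∫ x, |f x| ^ (c * P) ∂μ) ^ (1 / P) * (∫ x, |g x| ^ (d * Q) ∂μ) ^ (1 / Q) := by
  have := integral_mul_le_Lp_mul_Lq_of_nonneg hPQ (μ := μ) (f := fun x => |f x| ^ c)
    (g := fun x => |g x| ^ d) (ae_of_all _ fun x => by positivity)
    (ae_of_all _ fun x => by positivity) (memLp_abs_rpow hf hM hc _) (memLp_abs_rpow hg hM' hd _)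
  simpa only [← Real.rpow_mul (abs_nonneg _)] using this

lemma interp [IsFiniteMeasure μ] {f : α → ℝ} (hf : AEStronglyMeasurable f μ) {M : ℝ}
    (hM : ∀ᵐ x ∂μ, |f x| ≤ M) {l q r τ : ℝ} (hl : 0 < l) (hq : 0 < q) (hr : 0 < r) (h0 : 0 < τ) (h1 : τ < 1)
    (h : 1 / q = (1 - τ) / l + τ / r) :
    (∫ x, |f x| ^ q ∂μ) ^ (1 / q) ≤
      ((∫ x, |f x| ^ r ∂μ) ^ (1 / r)) ^ τ * ((∫ x, |f x| ^ l ∂μ) ^ (1 / l)) ^ (1 - τ) := by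
  have h1' : 0 < 1 - τ := by linarith
  have hPQ : (r / (τ * q)).HolderConjugate (l / ((1 - τ) * q)) := by
    refine Real.holderConjugate_iff.mpr ⟨?_, ?_⟩
    · rw [one_lt_div (by positivity)]
      have : 0 < (1 - τ) / l := by positivity
      have h2 : τ / r < 1 / q := by linarith
      rwa [div_lt_div_iff₀ hr hq, one_mul] at h2
    · rw [inv_div, inv_div]
      have : τ * q / r + (1 - τ) * q / l = q * ((1 - τ) / l + τ / r) := by ring
      rw [this, ← h]; field_simp
  have := holder_bdd hf hM hf hM hPQ (c := τ * q) (d := (1 - τ) * q) (by positivity) (by positivity)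
  have e1 : τ * q * (r / (τ * q)) = r := by field_simp
  have e2 : (1 - τ) * q * (l / ((1 - τ) * q)) = l := by field_simp
  rw [e1, e2] at this
  have e3 : ∀ x, |f x| ^ (τ * q) * |f x| ^ ((1 - τ) * q) = |f x| ^ q := by
    intro x
    rw [← Real.rpow_add_of_nonneg (abs_nonneg _) (by positivity) (by positivity)]
    congr 1; ring
  simp only [e3] at this
  have hr0 : 0 ≤ ∫ x, |f x| ^ r ∂μ := integral_nonneg fun x => by positivity
  have hl0 : 0 ≤ ∫ x, |f x| ^ l ∂μ := integral_nonneg fun x => by positivity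
  have hq0 : 0 ≤ ∫ x, |f x| ^ q ∂μ := integral_nonneg fun x => by positivity
  refine (Real.rpow_le_rpow hq0 this (by positivity)).trans (le_of_eq ?_)
  rw [Real.mul_rpow (by positivity) (by positivity), ← Real.rpow_mul hr0, ← Real.rpow_mul hl0,
    ← Real.rpow_mul hr0, ← Real.rpow_mul hl0]
  congr 2 <;> field_simp

lemma lp_mono [IsFiniteMeasure μ] {p q : ℝ} (hp : 0 < p) (hpq : p < q) :
    ∃ c : ℝ, 0 ≤ c ∧ ∀ (f : α → ℝ) (M : ℝ), AEStronglyMeasurable f μ → 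
    (∀ᵐ x ∂μ, |f x| ≤ M) → (∫ x, |f x| ^ p ∂μ) ^ (1 / p) ≤ c * (∫ x, |f x| ^ q ∂μ) ^ (1 / q) := by
  have hq : 0 < q := hp.trans hpq
  have hPQ := Real.HolderConjugate.conjExponent (p := q / p) (by rwa [one_lt_div hp])
  refine ⟨((μ.real Set.univ) ^ (1 / (q / p).conjExponent)) ^ (1 / p), by positivity, fun f M hf hM => ?_⟩
  have := holder_bdd (M := max M 1) hf (hM.mono fun x hx => hx.trans (le_max_left _ _))
     (aestronglyMeasurable_const (b := (1 : ℝ))) (ae_of_all _ fun x => by simp) hPQ hp.le zero_le_one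
  simp only [abs_one, Real.one_rpow, mul_one, integral_const, smul_eq_mul] at this
  rw [show p * (q / p) = q by field_simp] at this
  have hq0 : 0 ≤ ∫ x, |f x| ^ q ∂μ := integral_nonneg fun x => by positivity
  have hp0 : 0 ≤ ∫ x, |f x| ^ p ∂μ := integral_nonneg fun x => by positivity
  refine (Real.rpow_le_rpow hp0 this (by positivity)).trans (le_of_eq ?_)
  rw [Real.mul_rpow (by positivity) (by positivity), ← Real.rpow_mul hq0, mul_comm]
  congr 2
  field_simp

end abstractLp

lemma rpow_sum_le_sum {ι : Type*} (S : Finset ι) (f : ι → ℝ) (hf : ∀ i, 0 ≤ f i) {θ : ℝ} (h0 : 0 < θ)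
    (h1 : θ ≤ 1) : (∑ i ∈ S, f i) ^ θ ≤ ∑ i ∈ S, f i ^ θ := by
  classical
  induction S using Finset.induction_on with
  | empty => simp [Real.zero_rpow h0.ne']
  | insert i S hi ih =>
    rw [Finset.sum_insert hi, Finset.sum_insert hi]
    exact (Real.rpow_add_le_add_rpow (hf i) (Finset.sum_nonneg fun j _ => hf j) h0.le h1).trans
      (by gcongr)

lemma absorb {X A Y c τ : ℝ} (hX : 0 ≤ X) (hA : 0 ≤ A) (hY : 0 ≤ Y) (hc : 0 ≤ c) (h1 : τ < 1)
    (h : X ≤ c * (A + X ^ τ * Y ^ (1 - τ))) :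
    X ≤ (2 * c + (2 * c) ^ (1 / (1 - τ))) * (A + Y) := by
  have h1' : 0 < 1 - τ := by linarith
  rcases hX.eq_or_lt with h0 | hXp
  · rw [← h0]; positivity
  rcases le_total A (X ^ τ * Y ^ (1 - τ)) with hh | hh
  · have h2 : X ≤ 2 * c * (X ^ τ * Y ^ (1 - τ)) := by nlinarith
    have h3 : X ^ (1 - τ) ≤ 2 * c * Y ^ (1 - τ) := by
      have hp : 0 < X ^ τ := Real.rpow_pos_of_pos hXp _
      have : X ^ τ * X ^ (1 - τ) = X := by
        rw [← Real.rpow_add hXp]; simp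
      by_contra hcon
      push Not at hcon
      nlinarith
    have h4 := Real.rpow_le_rpow (by positivity) h3 (by positivity : 0 ≤ 1 / (1 - τ))
    rw [Real.mul_rpow (by positivity) (by positivity), ← Real.rpow_mul hX, ← Real.rpow_mul hY,
      mul_one_div_cancel h1'.ne', Real.rpow_one, Real.rpow_one] at h4
    have : 0 ≤ (2 * c) ^ (1 / (1 - τ)) := by positivity
    nlinarith [mul_nonneg hc hA, mul_nonneg hc hY, mul_nonneg this hA]
  · have h2 : X ≤ 2 * c * A := by nlinarith
    have : 0 ≤ (2 * c) ^ (1 / (1 - τ)) := by positivity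
    nlinarith [mul_nonneg hc hY, mul_nonneg this (add_nonneg hA hY)]
lemma Ka_eq {N : ℕ} (a : Fin N → ℝ) : Ka a = Set.univ.pi fun i => Set.Ioo (-a i) (a i) := by
  ext x; simp [Ka, abs_lt, Set.mem_pi]

lemma Ka_open {N : ℕ} (a : Fin N → ℝ) : IsOpen (Ka a) := by
  rw [Ka_eq]; exact isOpen_set_pi Set.finite_univ fun i _ => isOpen_Ioo

lemma Ka_closure_compact {N : ℕ} (a : Fin N → ℝ) : IsCompact (closure (Ka a)) := by
  have h : IsCompact (Set.univ.pi fun i => Set.Icc (-a i) (a i)) :=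
    isCompact_univ_pi fun i => isCompact_Icc
  refine h.closure_of_subset ?_
  rw [Ka_eq]
  exact Set.pi_mono fun i _ => Set.Ioo_subset_Icc_self

instance Ka_finite {N : ℕ} (a : Fin N → ℝ) : IsFiniteMeasure (volume.restrict (Ka a)) := by
  refine ⟨?_⟩
  rw [Measure.restrict_apply_univ]
  exact (measure_mono subset_closure).trans_lt (Ka_closure_compact a).measure_lt_top

lemma u_bdd {N : ℕ} (a : Fin N → ℝ) (ha : ∀ i, 0 < a i) (u : (Fin N → ℝ) → ℝ)
    (hu : ContDiffOn ℝ 1 u (closure (Ka a))) :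
    ∃ M : ℝ, (∀ x ∈ Ka a, |u x| ≤ M) ∧ ∀ i, ∀ x ∈ Ka a, |Dop i u x| ≤ M := by
  have hK := Ka_closure_compact a
  have hconv : Convex ℝ (closure (Ka a)) := by
    apply Convex.closure
    rw [Ka_eq]
    exact convex_pi fun i _ => convex_Ioo _ _
  have hun : UniqueDiffOn ℝ (closure (Ka a)) := by
    refine uniqueDiffOn_convex hconv ⟨0, ?_⟩
    have : Ka a ⊆ interior (closure (Ka a)) := (Ka_open a).subset_interior_closure
    exact this (by simpa [Ka] using ha)
  have h1 := hu.continuousOn_fderivWithin hun le_rfl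
  obtain ⟨M1, hM1⟩ := hK.exists_bound_of_continuousOn hu.continuousOn
  obtain ⟨M2, hM2⟩ := hK.exists_bound_of_continuousOn h1
  refine ⟨max M1 M2, fun x hx => (hM1 x (subset_closure hx)).trans (le_max_left _ _), fun i x hx => ?_⟩
  have h2 := hM2 x (subset_closure hx)
  rw [fderivWithin_of_mem_nhds (Filter.mem_of_superset ((Ka_open a).mem_nhds hx) subset_closure)] at h2
  refine le_trans ?_ (h2.trans (le_max_right _ _))
  have := (fderiv ℝ u x).le_opNorm (Pi.single i 1)
  rw [Pi.norm_single, norm_one, mul_one] at this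
  exact this

lemma sob (N : ℕ) (hN : 2 ≤ N) (a : Fin N → ℝ) (ha : ∀ i, 0 < a i)
    (p : Fin N → ℝ) (hp : ∀ i, 1 < p i) (r : ℝ) (hr : 0 < r)
    (hsum : ∑ i, (p i)⁻¹ = 1 + N / r) (u : (Fin N → ℝ) → ℝ) (hu : ContDiffOn ℝ 1 u (Ka a))
    (M : ℝ) (hM : ∀ x ∈ Ka a, |u x| ≤ M) (hM' : ∀ i, ∀ x ∈ Ka a, |Dop i u x| ≤ M) :
    Lnorm r (Ka a) u ≤ (∑ i, ((2 * a i)⁻¹ + (1 + r * (1 - (p i)⁻¹)))) * N *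
      ∑ i, (Lnorm (p i) (Ka a) (Dop i u) + Lnorm (p i) (Ka a) u) := by
  have hNr : (2 : ℝ) ≤ N := by exact_mod_cast hN
  have hKm : MeasurableSet (Ka a) := (Ka_open a).measurableSet
  set t : Fin N → ℝ := fun i => 1 + r * (1 - (p i)⁻¹) with ht
  have hpi : ∀ i, 0 < 1 - (p i)⁻¹ := fun i => by
    have := inv_lt_one_of_one_lt₀ (hp i); linarith
  have ht1 : ∀ i, 1 < t i := fun i => by
    have := mul_pos hr (hpi i); simp only [ht]; linarith
  set K : ℝ := ∑ i, ((2 * a i)⁻¹ + t i) with hK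
  set B : ℝ := ∑ i, (Lnorm (p i) (Ka a) (Dop i u) + Lnorm (p i) (Ka a) u) with hB
  have hLn : ∀ q v, 0 ≤ Lnorm q (Ka a) v := fun q v => by
    unfold Lnorm
    exact Real.rpow_nonneg (integral_nonneg fun x => by positivity) _
  have hB0 : 0 ≤ B := Finset.sum_nonneg fun i _ => add_nonneg (hLn _ _) (hLn _ _)
  have hterm : ∀ i, 0 < (2 * a i)⁻¹ + t i := fun i => by
    have := ha i; have := ht1 i; positivity
  have i0 : Fin N := ⟨0, by omega⟩
  have hKpos : 0 < K := Finset.sum_pos (fun i _ => hterm i) ⟨i0, Finset.mem_univ _⟩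
  set F : ℝ := ∫ x in Ka a, |u x| ^ r with hF
  have hF0 : 0 ≤ F := integral_nonneg fun x => by positivity
  rcases hF0.eq_or_lt with hFz | hFp
  · unfold Lnorm
    rw [← hF, ← hFz, Real.zero_rpow (by positivity)]
    positivity
  -- measurability and bounds
  have huc : ContinuousOn u (Ka a) := hu.continuousOn
  have hDc : ∀ i, ContinuousOn (Dop i u) (Ka a) := fun i => by
    unfold Dop
    exact (hu.continuousOn_fderiv_of_isOpen (Ka_open a) le_rfl).clm_apply continuousOn_const
  have hum : AEStronglyMeasurable u (volume.restrict (Ka a)) := huc.aestronglyMeasurable hKm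
  have hDm : ∀ i, AEStronglyMeasurable (Dop i u) (volume.restrict (Ka a)) :=
    fun i => (hDc i).aestronglyMeasurable hKm
  have hua : ∀ᵐ x ∂(volume.restrict (Ka a)), |u x| ≤ M := (ae_restrict_iff' hKm).mpr (ae_of_all _ hM)
  have hDa : ∀ i, ∀ᵐ x ∂(volume.restrict (Ka a)), |Dop i u x| ≤ M :=
    fun i => (ae_restrict_iff' hKm).mpr (ae_of_all _ (hM' i))
  have hBp : 0 < B := by
    have h1 : 0 < Lnorm (p i0) (Ka a) u := by
      refine lt_of_le_of_ne (hLn _ _) fun hz => ?_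
      have hp0 : p i0 ≠ 0 := by linarith [hp i0]
      have hz1 : ∫ x in Ka a, |u x| ^ (p i0) = 0 := by
        have hnn : 0 ≤ ∫ x in Ka a, |u x| ^ (p i0) := integral_nonneg fun x => by positivity
        have := hz.symm
        unfold Lnorm at this
        rw [Real.rpow_eq_zero hnn (by positivity)] at this
        exact this
      rw [integral_eq_zero_iff_of_nonneg (fun x => by positivity)
        (memLp_one_iff_integrable.mp (memLp_abs_rpow hum hua (by linarith [hp i0]) 1))] at hz1
      have : F = 0 := by
        rw [hF]
        apply integral_eq_zero_of_ae
        filter_upwards [hz1] with x hx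
        simp only [Pi.zero_apply] at hx ⊢
        rw [Real.rpow_eq_zero (abs_nonneg _) hp0] at hx
        rw [hx, Real.zero_rpow hr.ne']
      linarith
    refine Finset.sum_pos' (fun i _ => add_nonneg (hLn _ _) (hLn _ _)) ⟨i0, Finset.mem_univ _, ?_⟩
    have := hLn (p i0) (Dop i0 u)
    linarith
  set w : Fin N → (Fin N → ℝ) → ℝ := fun i x =>
    (2 * a i)⁻¹ * |u x| ^ t i + t i * |u x| ^ (t i - 1) * |Dop i u x| with hw
  have hw0 : ∀ i x, 0 ≤ w i x := fun i x => by
    have := ha i; have := ht1 i; simp only [hw]; positivity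
  set lam : Fin N → ℝ := fun i => K * B * F ^ (1 - (p i)⁻¹) with hlam
  have hlp : ∀ i, 0 < lam i := fun i => by
    simp only [hlam]; positivity
  -- Hölder
  have hol : ∀ i (g : (Fin N → ℝ) → ℝ), AEStronglyMeasurable g (volume.restrict (Ka a)) →
      (∀ᵐ x ∂(volume.restrict (Ka a)), |g x| ≤ M) →
      ∫ x in Ka a, |g x| ^ (1 : ℝ) * |u x| ^ (t i - 1) ≤ Lnorm (p i) (Ka a) g * F ^ (1 - (p i)⁻¹) := by
    intro i g hg hgM
    have hPQ := Real.HolderConjugate.conjExponent (hp i)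
    have h := holder_bdd hg hgM hum hua hPQ (c := 1) (d := t i - 1) zero_le_one (by linarith [ht1 i])
    have hQ : 1 / (p i).conjExponent = 1 - (p i)⁻¹ := by
      have := (Real.holderConjugate_iff.mp hPQ).2
      rw [one_div]; linarith
    have e : (t i - 1) * (p i).conjExponent = r := by
      have : (p i).conjExponent = 1 / (1 - (p i)⁻¹) := by rw [← hQ, one_div_one_div]
      rw [this, mul_one_div, div_eq_iff (hpi i).ne']; simp only [ht]; ring
    rw [e, hQ, one_mul] at h
    exact h
  have hint : ∀ i (g : (Fin N → ℝ) → ℝ), AEStronglyMeasurable g (volume.restrict (Ka a)) →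
      (∀ᵐ x ∂(volume.restrict (Ka a)), |g x| ≤ M) →
      Integrable (fun x => |g x| ^ (1 : ℝ) * |u x| ^ (t i - 1)) (volume.restrict (Ka a)) := by
    intro i g hg hgM
    exact (memLp_abs_rpow hg hgM zero_le_one 2).integrable_mul
      (memLp_abs_rpow hum hua (by linarith [ht1 i]) 2)
  have hweq : ∀ i, w i = fun x => (2 * a i)⁻¹ * (|u x| ^ (1 : ℝ) * |u x| ^ (t i - 1)) +
      t i * (|Dop i u x| ^ (1 : ℝ) * |u x| ^ (t i - 1)) := by
    intro i; funext x
    rw [← Real.rpow_add_of_nonneg (abs_nonneg _) zero_le_one (by linarith [ht1 i])]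
    simp only [hw, Real.rpow_one]
    rw [show 1 + (t i - 1) = t i by ring]; ring
  have hwint : ∀ i, Integrable (w i) (volume.restrict (Ka a)) := by
    intro i
    rw [hweq]
    exact ((hint i u hum hua).const_mul _).add ((hint i _ (hDm i) (hDa i)).const_mul _)
  have hwle : ∀ i, ∫ x in Ka a, w i x ≤ lam i := by
    intro i
    rw [hweq, integral_add ((hint i u hum hua).const_mul _) ((hint i _ (hDm i) (hDa i)).const_mul _),
      integral_const_mul, integral_const_mul]
    have hai : 0 < (2 * a i)⁻¹ := by have := ha i; positivity
    have hti : 0 < t i := by linarith [ht1 i]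
    have hFi : 0 < F ^ (1 - (p i)⁻¹) := by positivity
    have h1 : Lnorm (p i) (Ka a) (Dop i u) + Lnorm (p i) (Ka a) u ≤ B :=
      Finset.single_le_sum (f := fun i => Lnorm (p i) (Ka a) (Dop i u) + Lnorm (p i) (Ka a) u)
        (fun i _ => add_nonneg (hLn _ _) (hLn _ _)) (Finset.mem_univ i)
    have h2 : (2 * a i)⁻¹ + t i ≤ K :=
      Finset.single_le_sum (f := fun i => (2 * a i)⁻¹ + t i)
        (fun i _ => (hterm i).le) (Finset.mem_univ i)
    have hu1 : Lnorm (p i) (Ka a) u ≤ B := by linarith [hLn (p i) (Dop i u)]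
    have hd1 : Lnorm (p i) (Ka a) (Dop i u) ≤ B := by linarith [hLn (p i) u]
    calc _ ≤ (2 * a i)⁻¹ * (B * F ^ (1 - (p i)⁻¹)) + t i * (B * F ^ (1 - (p i)⁻¹)) := by
          have := hol i u hum hua
          have := hol i _ (hDm i) (hDa i)
          gcongr
          · exact (hol i u hum hua).trans (by gcongr)
          · exact (hol i _ (hDm i) (hDa i)).trans (by gcongr)
      _ = ((2 * a i)⁻¹ + t i) * B * F ^ (1 - (p i)⁻¹) := by ring
      _ ≤ K * B * F ^ (1 - (p i)⁻¹) := by gcongr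
  set W : (Fin N → ℝ) → ℝ := fun x => ∑ i, (lam i)⁻¹ * w i x with hW
  have hW0 : ∀ x, 0 ≤ W x := fun x => Finset.sum_nonneg fun i _ =>
    mul_nonneg (inv_nonneg.mpr (hlp i).le) (hw0 i x)
  have hWi : Integrable W (volume.restrict (Ka a)) :=
    integrable_finsetSum _ fun i _ => (hwint i).const_mul _
  have hWle : ∫ x in Ka a, W x ≤ N := by
    rw [hW, integral_finsetSum _ fun i _ => (hwint i).const_mul _]
    calc _ ≤ ∑ i : Fin N, (1 : ℝ) := by
          refine Finset.sum_le_sum fun i _ => ?_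
          rw [integral_const_mul]
          rw [inv_mul_le_iff₀ (hlp i), mul_one]
          exact hwle i
      _ = N := by simp
  set f : (Fin N → ℝ) → ENNReal := (Ka a).indicator (fun x => ENNReal.ofReal (W x)) with hf
  have hwc : ∀ i, ContinuousOn (w i) (Ka a) := fun i => by
    have h1 : 0 ≤ t i := by linarith [ht1 i]
    have h2 : 0 ≤ t i - 1 := by linarith [ht1 i]
    simp only [hw]
    exact (continuousOn_const.mul (huc.abs.rpow_const fun x _ => Or.inr h1)).add
      ((continuousOn_const.mul (huc.abs.rpow_const fun x _ => Or.inr h2)).mul (hDc i).abs)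
  have hfm : Measurable f := by
    classical
    have hWc : ContinuousOn (fun x => ENNReal.ofReal (W x)) (Ka a) := by
      refine ENNReal.continuous_ofReal.comp_continuousOn ?_
      exact continuousOn_finsetSum _ fun i _ => continuousOn_const.mul (hwc i)
    have := hWc.measurable_piecewise (g := fun _ => 0) continuousOn_const hKm
    rw [hf, ← Set.piecewise_eq_indicator]
    exact this
  set μ : Fin N → Measure ℝ := fun i => volume.restrict (Set.Ioo (-a i) (a i)) with hμ
  have hμpi : volume.restrict (Ka a) = Measure.pi μ := by
    rw [Ka_eq, volume_pi, Measure.restrict_pi_pi]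
  have hfint : ∫⁻ x, f x ∂(Measure.pi μ) ≤ ENNReal.ofReal N := by
    rw [← hμpi, hf, setLIntegral_indicator hKm, Set.inter_self,
      ← ofReal_integral_eq_lintegral_ofReal hWi (ae_of_all _ hW0)]
    exact ENNReal.ofReal_le_ofReal hWle
  -- pointwise
  have hpt : ∀ x ∈ Ka a, ∀ i, ENNReal.ofReal (|u x| ^ t i) ≤
      ENNReal.ofReal (lam i) * ∫⁻ y, f (Function.update x i y) ∂(μ i) := by
    intro x hx i
    have hmem : ∀ y ∈ Set.Ioo (-a i) (a i), Function.update x i y ∈ Ka a := by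
      intro y hy j
      rcases eq_or_ne j i with rfl | hj
      · rw [Function.update_self]; exact abs_lt.mpr hy
      · rw [Function.update_of_ne hj]; exact hx j
    have hcd : ContDiffOn ℝ 1 (fun y => u (Function.update x i y)) (Set.Ioo (-a i) (a i)) :=
      hu.comp (contDiff_update 1 x i).contDiffOn hmem
    have hder : ∀ y ∈ Set.Ioo (-a i) (a i), deriv (fun y => u (Function.update x i y)) y =
        Dop i u (Function.update x i y) := by
      intro y hy
      have h1 : HasFDerivAt u (fderiv ℝ u (Function.update x i y)) (Function.update x i y) :=
        ((hu.differentiableOn (by norm_num)).differentiableAt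
          ((Ka_open a).mem_nhds (hmem y hy))).hasFDerivAt
      exact (h1.comp_hasDerivAt y (hasDerivAt_update x i y)).deriv
    have h := oneD (a i) (ha i) _ hcd (t i) (ht1 i) (x i) (abs_lt.mp (hx i))
    simp only [Function.update_eq_self] at h
    refine h.trans ?_
    rw [← lintegral_const_mul' _ _ ENNReal.ofReal_ne_top]
    refine setLIntegral_mono' measurableSet_Ioo fun y hy => ?_
    rw [hder y hy, hf, Set.indicator_of_mem (hmem y hy), ← ENNReal.ofReal_mul (hlp i).le]
    apply ENNReal.ofReal_le_ofReal
    have h3 : (lam i)⁻¹ * w i (Function.update x i y) ≤ W (Function.update x i y) :=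
      Finset.single_le_sum (f := fun j => (lam j)⁻¹ * w j (Function.update x i y))
        (fun j _ => mul_nonneg (inv_nonneg.mpr (hlp j).le) (hw0 j _)) (Finset.mem_univ i)
    rw [inv_mul_le_iff₀ (hlp i)] at h3
    exact h3
  have hN1 : 0 < (N : ℝ) - 1 := by linarith
  set e : ℝ := 1 / ((N : ℝ) - 1) with he
  have hep : 0 < e := by positivity
  have htsum : ∑ i, t i = r * (N - 1) := by
    simp only [ht, Finset.sum_add_distrib, ← Finset.mul_sum, Finset.sum_sub_distrib, hsum]
    simp; field_simp; ring
  have hprod : ∀ x, ENNReal.ofReal (|u x| ^ r) = ∏ i, (ENNReal.ofReal (|u x| ^ t i)) ^ e := by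
    intro x
    have : |u x| ^ r = ∏ i, (|u x| ^ t i) ^ e := by
      rw [Real.finsetProd_rpow _ _ (fun i _ => by positivity),
        ← Real.rpow_sum_of_nonneg (abs_nonneg _) (fun i _ => by linarith [ht1 i]), htsum,
        ← Real.rpow_mul (abs_nonneg _)]
      congr 1; rw [he]; field_simp
    rw [this, ENNReal.ofReal_prod_of_nonneg (fun i _ => by positivity)]
    exact Finset.prod_congr rfl fun i _ => (ENNReal.ofReal_rpow_of_nonneg (by positivity) hep.le).symm
  have hconj : Real.HolderConjugate (Fintype.card (Fin N) : ℝ) (N * e) := by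
    rw [Fintype.card_fin, Real.holderConjugate_iff]
    refine ⟨by linarith, ?_⟩
    rw [he]; field_simp; ring
  have hgrid := lintegral_prod_lintegral_pow_le μ hconj hfm
  rw [Fintype.card_fin, ← he] at hgrid
  have hmain : ENNReal.ofReal F ≤ ENNReal.ofReal ((∏ i, lam i ^ e) * (N : ℝ) ^ (N * e)) := by
    calc ENNReal.ofReal F = ∫⁻ x in Ka a, ENNReal.ofReal (|u x| ^ r) :=
          ofReal_integral_eq_lintegral_ofReal
            (memLp_one_iff_integrable.mp (memLp_abs_rpow hum hua hr.le 1))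
            (ae_of_all _ fun x => by positivity)
      _ ≤ ∫⁻ x in Ka a, (∏ i, ENNReal.ofReal (lam i) ^ e) *
            ∏ i, (∫⁻ y, f (Function.update x i y) ∂(μ i)) ^ e := by
          refine setLIntegral_mono' hKm fun x hx => ?_
          rw [hprod, ← Finset.prod_mul_distrib]
          refine Finset.prod_le_prod' fun i _ => ?_
          rw [← ENNReal.mul_rpow_of_nonneg _ _ hep.le]
          exact ENNReal.rpow_le_rpow (hpt x hx i) hep.le
      _ = (∏ i, ENNReal.ofReal (lam i) ^ e) * ∫⁻ x in Ka a,
            ∏ i, (∫⁻ y, f (Function.update x i y) ∂(μ i)) ^ e := by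
          refine lintegral_const_mul' _ _ ?_
          refine ENNReal.prod_ne_top fun i _ => ?_
          exact ENNReal.rpow_ne_top_of_nonneg hep.le ENNReal.ofReal_ne_top
      _ ≤ (∏ i, ENNReal.ofReal (lam i) ^ e) * (ENNReal.ofReal N) ^ (N * e) := by
          rw [hμpi]
          gcongr
          exact hgrid.trans (ENNReal.rpow_le_rpow hfint (by positivity))
      _ = _ := by
          rw [ENNReal.ofReal_mul (Finset.prod_nonneg fun i _ => Real.rpow_nonneg (hlp i).le _),
            ENNReal.ofReal_prod_of_nonneg (fun i _ => Real.rpow_nonneg (hlp i).le _),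
            ENNReal.ofReal_rpow_of_nonneg (by positivity) (by positivity)]
          congr 1
          exact Finset.prod_congr rfl fun i _ => ENNReal.ofReal_rpow_of_nonneg (hlp i).le hep.le
  have hRnn : 0 ≤ (∏ i, lam i ^ e) * (N : ℝ) ^ (N * e) :=
    mul_nonneg (Finset.prod_nonneg fun i _ => Real.rpow_nonneg (hlp i).le _) (by positivity)
  rw [ENNReal.ofReal_le_ofReal_iff hRnn] at hmain
  have hpl : ∏ i, lam i ^ e = (K * B) ^ (N * e) * F ^ (1 - N * e / r) := by
    rw [Real.finsetProd_rpow _ _ (fun i _ => (hlp i).le)]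
    simp only [hlam]
    rw [Finset.prod_mul_distrib, Finset.prod_const, Finset.card_univ, Fintype.card_fin,
      ← Real.rpow_sum_of_pos hFp, Real.mul_rpow (by positivity) (by positivity),
      ← Real.rpow_natCast, ← Real.rpow_mul (by positivity), ← Real.rpow_mul hF0]
    congr 2
    rw [Finset.sum_sub_distrib, hsum]
    simp
    rw [he]; field_simp; ring
  rw [hpl, mul_right_comm, ← Real.mul_rpow (by positivity) (by positivity)] at hmain
  have h5 : F ^ (N * e / r) ≤ (K * B * N) ^ (N * e) := by
    have h6 : F = F ^ (N * e / r) * F ^ (1 - N * e / r) := by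
      rw [← Real.rpow_add hFp]; simp
    have h7 : 0 < F ^ (1 - N * e / r) := by positivity
    by_contra hcon
    push Not at hcon
    have := mul_lt_mul_of_pos_right hcon h7
    linarith
  have hNe : 0 < N * e := by positivity
  have h8 : (F ^ (1 / r)) ^ (N * e) ≤ (K * B * N) ^ (N * e) := by
    rw [← Real.rpow_mul hF0]
    convert h5 using 2
    ring
  have h9 := (Real.rpow_le_rpow_iff (by positivity) (by positivity) hNe).mp h8
  unfold Lnorm
  rw [← hF]
  linarith

set_option maxHeartbeats 1000000

theorem stmt7 (N : ℕ) (hN : 2 ≤ N) (a : Fin N → ℝ) (ha : ∀ i, 0 < a i)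
    (p : Fin N → ℝ) (hp : ∀ i, 2 * N / (N + 2) < p i)
    (ph phs : ℝ) (hph : ph = N / ∑ i, (p i)⁻¹) (hphN : ph < N)
    (hphs : phs = N * ph / (N - ph)) (hpv : ∀ i, p i < phs)
    (s : ℝ) (hs2 : 2 < s) (hs : s < phs)
    (θ : ℝ) (hθ : θ = (1 / 2 - 1 / s) / ((N + 2) / (2 * N) - 1 / ph)) :
    (0 < θ ∧ θ < 1) ∧
    ∃ C : ℝ, 0 < C ∧
      ∀ u : (Fin N → ℝ) → ℝ, ContDiffOn ℝ 1 u (closure (Ka a)) →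
        Lnorm s (Ka a) u ≤
          C * (∑ i, (Lnorm (p i) (Ka a) (Dop i u) + Lnorm 2 (Ka a) u) ^ θ) *
            Lnorm 2 (Ka a) u ^ (1 - θ) := by
  have hNr : (2 : ℝ) ≤ N := by exact_mod_cast hN
  have hp1 : ∀ i, 1 < p i := fun i => by
    refine lt_of_le_of_lt ?_ (hp i)
    rw [le_div_iff₀ (by positivity)]; linarith
  have i0 : Fin N := ⟨0, by omega⟩
  have hSpos : 0 < ∑ i, (p i)⁻¹ :=
    Finset.sum_pos (fun i _ => inv_pos.mpr (by linarith [hp1 i])) ⟨i0, Finset.mem_univ _⟩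
  have hphp : 0 < ph := by rw [hph]; positivity
  have hsub : 0 < (N : ℝ) - ph := by linarith
  have hrp : 0 < phs := by rw [hphs]; positivity
  have hrinv : 1 / phs = 1 / ph - 1 / N := by
    rw [hphs]; field_simp
  have hsum : ∑ i, (p i)⁻¹ = 1 + N / phs := by
    have h1 : ∑ i, (p i)⁻¹ = N / ph := by rw [hph]; field_simp
    rw [h1, div_eq_mul_one_div (N : ℝ) phs, hrinv]; field_simp; ring
  have hden : ((N : ℝ) + 2) / (2 * N) - 1 / ph = 1 / 2 - 1 / phs := by
    rw [hrinv]; field_simp; ring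
  rw [hden] at hθ
  have hlt : ∀ {x y : ℝ}, 0 < x → x < y → 1 / y < 1 / x := fun hx hxy => one_div_lt_one_div_of_lt hx hxy
  have hsr : 1 / phs < 1 / s := hlt (by linarith) hs
  -- general interpolation parameter
  have hpar : ∀ q : ℝ, 2 < q → q < phs → ∀ τ, τ = (1 / 2 - 1 / q) / (1 / 2 - 1 / phs) →
      0 < τ ∧ τ < 1 ∧ 1 / q = (1 - τ) / 2 + τ / phs := by
    intro q h2 hq τ hτ
    have h3 := hlt two_pos h2
    have h4 := hlt (by linarith : 0 < q) hq
    have hd : 0 < 1 / 2 - 1 / phs := by linarith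
    refine ⟨by rw [hτ]; exact div_pos (by linarith) hd, by rw [hτ, div_lt_one hd]; linarith, ?_⟩
    have : τ * (1 / 2 - 1 / phs) = 1 / 2 - 1 / q := by rw [hτ]; exact div_mul_cancel₀ _ hd.ne'
    rw [div_eq_mul_one_div τ phs, div_eq_mul_one_div (1 - τ) 2]
    linarith
  obtain ⟨hθ0, hθ1, hθe⟩ := hpar s hs2 hs θ hθ
  refine ⟨⟨hθ0, hθ1⟩, ?_⟩
  obtain ⟨im, -, him⟩ := Finset.exists_max_image Finset.univ p ⟨i0, Finset.mem_univ _⟩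
  obtain ⟨q, hq1, hq2⟩ := exists_between (max_lt (hpv im) hs)
  have hq2' : 2 < q := hs2.trans ((le_max_right _ _).trans_lt hq1)
  have hpq : ∀ i, p i < q := fun i =>
    (him i (Finset.mem_univ _)).trans_lt ((le_max_left _ _).trans_lt hq1)
  obtain ⟨hτ0, hτ1, hτe⟩ := hpar q hq2' hq2 _ rfl
  set τ := (1 / 2 - 1 / q) / (1 / 2 - 1 / phs)
  choose c hc0 hc using fun i => lp_mono (μ := volume.restrict (Ka a))
    (by linarith [hp1 i] : 0 < p i) (hpq i)
  set c' : ℝ := 1 + ∑ i, c i with hc'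
  have hcs : 0 ≤ ∑ i, c i := Finset.sum_nonneg fun i _ => hc0 i
  set K : ℝ := (∑ i, ((2 * a i)⁻¹ + (1 + phs * (1 - (p i)⁻¹)))) * N with hK
  have hK0 : 0 ≤ K := by
    refine mul_nonneg (Finset.sum_nonneg fun i _ => ?_) (by positivity)
    have := inv_lt_one_of_one_lt₀ (hp1 i)
    have h2 : 0 < 1 - (p i)⁻¹ := by linarith
    have := ha i
    positivity
  set C1 : ℝ := 2 * (K * c') + (2 * (K * c')) ^ (1 / (1 - τ)) with hC1
  have hKc : 0 ≤ K * c' := by positivity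
  have hC10 : 0 ≤ C1 := by positivity
  refine ⟨(C1 + 1) ^ θ, by positivity, fun u hu => ?_⟩
  obtain ⟨M, hM, hM'⟩ := u_bdd a ha u hu
  have hKm : MeasurableSet (Ka a) := (Ka_open a).measurableSet
  have hu' := hu.mono subset_closure
  have hum : AEStronglyMeasurable u (volume.restrict (Ka a)) := hu'.continuousOn.aestronglyMeasurable hKm
  have hua : ∀ᵐ x ∂(volume.restrict (Ka a)), |u x| ≤ M := (ae_restrict_iff' hKm).mpr (ae_of_all _ hM)
  have hLn : ∀ q v, 0 ≤ Lnorm q (Ka a) v := fun q v => by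
    unfold Lnorm
    exact Real.rpow_nonneg (integral_nonneg fun x => by positivity) _
  have hsob := sob N hN a ha p hp1 phs hrp hsum u hu' M hM hM'
  have his : Lnorm s (Ka a) u ≤ Lnorm phs (Ka a) u ^ θ * Lnorm 2 (Ka a) u ^ (1 - θ) :=
    interp hum hua two_pos (by linarith) hrp hθ0 hθ1 hθe
  have hiq : Lnorm q (Ka a) u ≤ Lnorm phs (Ka a) u ^ τ * Lnorm 2 (Ka a) u ^ (1 - τ) :=
    interp hum hua two_pos (by linarith) hrp hτ0 hτ1 hτe
  have hmono : ∀ i, Lnorm (p i) (Ka a) u ≤ c i * Lnorm q (Ka a) u := fun i => hc i u M hum hua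
  set X := Lnorm phs (Ka a) u
  set Y := Lnorm 2 (Ka a) u
  have hX : 0 ≤ X := hLn _ _
  have hY : 0 ≤ Y := hLn _ _
  set A := ∑ i, Lnorm (p i) (Ka a) (Dop i u) with hA
  have hA0 : 0 ≤ A := Finset.sum_nonneg fun i _ => hLn _ _
  have hXle : X ≤ K * c' * (A + X ^ τ * Y ^ (1 - τ)) := by
    refine hsob.trans ?_
    rw [← hK, mul_assoc K c']
    refine mul_le_mul_of_nonneg_left ?_ hK0
    rw [Finset.sum_add_distrib]
    have h1 : ∑ i, Lnorm (p i) (Ka a) u ≤ (∑ i, c i) * (X ^ τ * Y ^ (1 - τ)) := by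
      rw [Finset.sum_mul]
      exact Finset.sum_le_sum fun i _ => (hmono i).trans (mul_le_mul_of_nonneg_left hiq (hc0 i))
    have h2 : 0 ≤ X ^ τ * Y ^ (1 - τ) := by positivity
    have h3 := mul_nonneg hcs hA0
    rw [hc', ← hA]
    linarith
  have hXf := absorb hX hA0 hY hKc hτ1 hXle
  rw [← hC1] at hXf
  have hAY : A + Y ≤ ∑ i, (Lnorm (p i) (Ka a) (Dop i u) + Y) := by
    rw [Finset.sum_add_distrib, ← hA]
    simp only [Finset.sum_const, Finset.card_univ, Fintype.card_fin, nsmul_eq_mul]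
    nlinarith
  have hXg : X ≤ (C1 + 1) * ∑ i, (Lnorm (p i) (Ka a) (Dop i u) + Y) := by
    refine hXf.trans ?_
    have h0 : 0 ≤ A + Y := by positivity
    exact mul_le_mul (by linarith) hAY h0 (by positivity)
  refine his.trans (mul_le_mul_of_nonneg_right ?_ (by positivity))
  refine (Real.rpow_le_rpow hX hXg hθ0.le).trans ?_
  rw [Real.mul_rpow (by positivity) (Finset.sum_nonneg fun i _ => add_nonneg (hLn _ _) hY)]
  exact mul_le_mul_of_nonneg_left
    (rpow_sum_le_sum _ _ (fun i => add_nonneg (hLn _ _) hY) hθ0 hθ1.le) (by positivity)
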